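/- (Principle N) For every modal formula φ, the formula □φ ↔ (φ≡⊤) is a theorem of S1+SP (derivable from the empty set of premises). -/

import Mathlib

/-- Modal formulas over countably many propositional variables x₀, x₁, …. -/
inductive Fm : Type
  | var : ℕ → Fm
  | neg : Fm → Fm
  | imp : Fm → Fm → Fm
  | box : Fm → Fm
deriving DecidableEq

namespace Fm

/-- ⊤ := x₀ → x₀ -/
def top : Fm := imp (var 0) (var 0)

/-- φ ∧ ψ := ¬(φ → ¬ψ) -/
def conj (φ ψ : Fm) : Fm := neg (imp φ (neg ψ))

/-- φ ↔ ψ := (φ → ψ) ∧ (ψ → φ) -/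
def biimp (φ ψ : Fm) : Fm := conj (imp φ ψ) (imp ψ φ)

/-- strict equivalence: φ ≡ ψ := □(φ → ψ) ∧ □(ψ → φ) -/
def equiv (φ ψ : Fm) : Fm := conj (box (imp φ ψ)) (box (imp ψ φ))

/-- φ[x := ψ]: substitution of ψ for all occurrences of the variable x in φ. -/
def subst (φ : Fm) (x : ℕ) (ψ : Fm) : Fm :=
  match φ with
  | var y => if y = x then ψ else var y
  | neg χ => neg (subst χ x ψ)
  | imp χ δ => imp (subst χ x ψ) (subst δ x ψ)
  | box χ => box (subst χ x ψ)

/-- Propositional (two-valued) evaluation of a modal formula, treating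
variables and boxed formulas as atoms. -/
def pEval (v : Fm → Bool) : Fm → Bool
  | var n => v (var n)
  | neg φ => !(pEval v φ)
  | imp φ ψ => !(pEval v φ) || pEval v ψ
  | box φ => v (box φ)

/-- φ has the form of a propositional tautology, i.e. φ is a substitution
instance of a propositional tautology. -/
def isTautInstance (φ : Fm) : Prop := ∀ v : Fm → Bool, pEval v φ = true

/-- The axioms (i)–(iii) of Lewis system S1 (Lemmon-style). -/
inductive S1Axiom : Fm → Prop
  | taut {φ} : isTautInstance φ → S1Axiom φ
  | ax2 (φ) : S1Axiom (imp (box φ) φ)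
  | ax3 (φ ψ χ) :
      S1Axiom (imp (conj (box (imp φ ψ)) (box (imp ψ χ))) (box (imp φ χ)))

/-- The identity axioms (iv)–(vi), i.e. the Substitution Principle SP. -/
inductive SPAxiom : Fm → Prop
  | ax4 (φ ψ) : SPAxiom (imp (equiv φ ψ) (equiv (neg φ) (neg ψ)))
  | ax5 (φ ψ φ' ψ') :
      SPAxiom (imp (conj (equiv φ ψ) (equiv φ' ψ'))
        (equiv (imp φ φ') (imp ψ ψ')))
  | ax6 (φ ψ) : SPAxiom (imp (equiv φ ψ) (equiv (box φ) (box ψ)))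

/-- Derivability in S1+SP from a set Φ of premises: axioms (i)–(vi),
modus ponens, and Axiom Necessitation AN restricted to axioms (i)–(iii). -/
inductive S1SP : Set Fm → Fm → Prop
  | prem {Φ φ} : φ ∈ Φ → S1SP Φ φ
  | axm {Φ φ} : S1Axiom φ → S1SP Φ φ
  | spAxm {Φ φ} : SPAxiom φ → S1SP Φ φ
  | mp {Φ φ ψ} : S1SP Φ (imp φ ψ) → S1SP Φ φ → S1SP Φ ψ
  | an {Φ φ} : S1Axiom φ → S1SP Φ (box φ)

end Fm

open Fm in
theorem taut_mp {a b : Fm} (ha : S1SP ∅ a) (h : isTautInstance (imp a b)) : S1SP ∅ b :=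
  S1SP.mp (S1SP.axm (S1Axiom.taut h)) ha

open Fm in
theorem conj_intro {a b : Fm} (ha : S1SP ∅ a) (hb : S1SP ∅ b) : S1SP ∅ (conj a b) := by
  refine S1SP.mp (S1SP.mp (S1SP.axm (S1Axiom.taut ?_)) ha) hb
  intro v
  simp only [conj, pEval]
  cases pEval v a <;> cases pEval v b <;> rfl

open Fm in
/-- Principle N: □φ ↔ (φ ≡ ⊤) is a theorem of S1+SP. -/
theorem principle_N (φ : Fm) :
    S1SP ∅ (biimp (box φ) (equiv φ Fm.top)) := by
  have hA : S1SP ∅ (box (imp φ Fm.top)) := by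
    refine S1SP.an (S1Axiom.taut ?_)
    intro v
    simp only [Fm.top, pEval]
    cases pEval v φ <;> cases v (var 0) <;> rfl
  have h1 : S1SP ∅ (box (imp φ (imp Fm.top φ))) := by
    refine S1SP.an (S1Axiom.taut ?_)
    intro v
    simp only [Fm.top, pEval]
    cases pEval v φ <;> cases v (var 0) <;> rfl
  have h2 : S1SP ∅ (box (imp (imp Fm.top φ) φ)) := by
    refine S1SP.an (S1Axiom.taut ?_)
    intro v
    simp only [Fm.top, pEval]
    cases pEval v φ <;> cases v (var 0) <;> rfl
  have hE := S1SP.mp (S1SP.spAxm (SPAxiom.ax6 φ (imp Fm.top φ))) (conj_intro h1 h2)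
  have h3 : S1SP ∅ (imp (box φ) (box (imp Fm.top φ))) := by
    refine S1SP.mp (S1SP.axm (S1Axiom.ax2 _)) (taut_mp hE ?_)
    intro v
    simp only [equiv, conj, pEval]
    generalize v (box (imp (box φ) _)) = p
    generalize v (box (imp (box (imp Fm.top φ)) _)) = q
    cases p <;> cases q <;> rfl
  have h4 : S1SP ∅ (imp (box (imp Fm.top φ)) (box φ)) := by
    refine S1SP.mp (S1SP.axm (S1Axiom.ax2 _)) (taut_mp hE ?_)
    intro v
    simp only [equiv, conj, pEval]
    generalize v (box (imp (box φ) _)) = p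
    generalize v (box (imp (box (imp Fm.top φ)) _)) = q
    cases p <;> cases q <;> rfl
  refine taut_mp (conj_intro hA (conj_intro h3 h4)) ?_
  intro v
  simp only [biimp, equiv, conj, pEval]
  generalize v (box φ) = p
  generalize v (box (imp φ Fm.top)) = q
  generalize v (box (imp Fm.top φ)) = r
  cases p <;> cases q <;> cases r <;> rfl
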